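/- arXiv:1902.05957 — 4 statements merged into one kernel-verified Lean document; each statement's English description precedes it below -/
import Mathlib

section
/- For every n ≥ 1, every periodic binary string μ : ℤ/2n → ℤ and every antiperiodic binary string ν : ℤ/2n → ℤ, the integer T(μ,ν) = Σ_{i ∈ ℤ/2n} μ(i)·par(ν(i+1) − ν(i)) is even. (Hence every matrix element of e^{πi/4}·U₂₁, which is proportional to i^{T(μ,ν)}, is real, as claimed in the paper.) -/
instance (n : ℕ) [NeZero n] : NeZero (2 * n) :=
  ⟨Nat.mul_ne_zero two_ne_zero (NeZero.ne n)⟩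

/-- `par x = 0` if `x` is even and `par x = 1` if `x` is odd. -/
def par (x : ℤ) : ℤ := x % 2

/-- `T(μ,ν) = Σ_{i ∈ ℤ/m} μ(i)·par(ν(i+1) − ν(i))`. -/
def Tmat (m : ℕ) [NeZero m] (μ ν : ZMod m → ℤ) : ℤ :=
  ∑ i : ZMod m, μ i * par (ν (i + 1) - ν i)

/-- `μ : ℤ/2n → ℤ` is a periodic binary string: it takes values in `{0,1}`
and satisfies `μ(i+n) = μ(i)` for all `i`. -/
def IsPeriodic (n : ℕ) (μ : ZMod (2 * n) → ℤ) : Prop :=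
  (∀ i, μ i = 0 ∨ μ i = 1) ∧ ∀ i, μ (i + (n : ZMod (2 * n))) = μ i

/-- `ν : ℤ/2n → ℤ` is an antiperiodic binary string: it takes values in `{0,1}`
and satisfies `ν(i+n) = 1 − ν(i)` for all `i`. -/
def IsAntiperiodic (n : ℕ) (ν : ZMod (2 * n) → ℤ) : Prop :=
  (∀ i, ν i = 0 ∨ ν i = 1) ∧ ∀ i, ν (i + (n : ZMod (2 * n))) = 1 - ν i

/-- For a periodic binary string `μ` and an antiperiodic binary string `ν` on `ℤ/2n`,
the exponent `T(μ,ν)` is even; hence every matrix element of `e^{πi/4}·U₂₁`, which is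
proportional to `i^{T(μ,ν)}`, is real. -/
theorem Tmat_even (n : ℕ) [NeZero n] (μ ν : ZMod (2 * n) → ℤ)
    (hμ : IsPeriodic n μ) (hν : IsAntiperiodic n ν) :
    Even (Tmat (2 * n) μ ν) := by
  have hpar : ∀ x : ℤ, par (-x) = par x := fun x => by unfold par; omega
  have hne : ∀ i, i + (n : ZMod (2 * n)) ≠ i := fun i h => by
    have := hν.2 i
    rw [h] at this
    omega
  have hshift : ∀ i, μ (i + n) * par (ν (i + n + 1) - ν (i + n)) =
      μ i * par (ν (i + 1) - ν i) := fun i => by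
    rw [hμ.2, add_right_comm, hν.2, hν.2, sub_sub_sub_cancel_left, ← neg_sub, hpar]
  have hn : (n : ZMod (2 * n)) + n = 0 := by
    have := ZMod.natCast_self (2 * n)
    rwa [two_mul n, Nat.cast_add, ← two_mul n] at this
  rw [even_iff_two_dvd, ← Nat.cast_two, ← ZMod.intCast_zmod_eq_zero_iff_dvd, Tmat, Int.cast_sum]
  refine Finset.sum_involution (fun i _ => i + n) (fun i _ => ?_) (fun i _ _ => hne i)
    (fun i _ => Finset.mem_univ _) (fun i _ => ?_)
  · rw [hshift]
    exact CharTwo.add_self_eq_zero _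
  · rw [add_assoc, hn, add_zero]
end

section
/- For every n ≥ 1, every periodic binary string μ : ℤ/2n → ℤ and every antiperiodic binary string ν : ℤ/2n → ℤ, one has (in ℂ): i^{T(1−μ, ν)} = − i^{T(μ, ν)}, and T(μ, 1−ν) = T(μ, ν). (This is the paper's relation ⟨ν ν̄|U₂₁|μ̄ μ̄⟩ = −⟨ν ν̄|U₂₁|μ μ⟩ together with ⟨ν̄ ν|U₂₁|μ μ⟩ = ⟨ν ν̄|U₂₁|μ μ⟩.) -/
theorem ZMod.sum_eq_sum_range (m : ℕ) [NeZero m] (f : ZMod m → ℤ) :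
    ∑ i, f i = ∑ k ∈ Finset.range m, f k := by
  refine Finset.sum_bij' (fun i _ => i.val) (fun k _ => (k : ZMod m)) ?_ ?_ ?_ ?_ ?_
  · intro i _
    exact Finset.mem_range.2 i.val_lt
  · intro k _
    exact Finset.mem_univ _
  · intro i _
    exact ZMod.natCast_zmod_val i
  · intro k hk
    exact ZMod.val_cast_of_lt (Finset.mem_range.1 hk)
  · intro i _
    rw [ZMod.natCast_zmod_val]

theorem ZMod.sum_eq_two_mul_sum_range (n : ℕ) [NeZero n] (f : ZMod (2 * n) → ℤ)
    (hf : ∀ i, f (i + (n : ZMod (2 * n))) = f i) :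
    ∑ i, f i = 2 * ∑ k ∈ Finset.range n, f k := by
  rw [ZMod.sum_eq_sum_range]
  have h := Finset.sum_range_add (fun k : ℕ => f (k : ZMod (2 * n))) n n
  rw [← two_mul] at h
  rw [h, two_mul (∑ k ∈ Finset.range n, f k)]
  congr 1
  refine Finset.sum_congr rfl fun k _ => ?_
  rw [Nat.cast_add, add_comm, hf]

theorem par_neg (x : ℤ) : par (-x) = par x := by
  unfold par
  omega

theorem IsAntiperiodic.par_add {n : ℕ} {ν : ZMod (2 * n) → ℤ} (hν : IsAntiperiodic n ν)
    (i : ZMod (2 * n)) :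
    par (ν (i + (n : ZMod (2 * n)) + 1) - ν (i + (n : ZMod (2 * n)))) =
      par (ν (i + 1) - ν i) := by
  rw [add_right_comm, hν.2, hν.2, ← par_neg]
  congr 1
  ring

/-- An antiperiodic binary string has an odd number of jumps in half a period. -/
theorem IsAntiperiodic.odd_sum_par {n : ℕ} {ν : ZMod (2 * n) → ℤ} (hν : IsAntiperiodic n ν) :
    Odd (∑ k ∈ Finset.range n, par (ν ((k : ZMod (2 * n)) + 1) - ν k)) := by
  have h := Finset.sum_range_sub (fun k : ℕ => ν (k : ZMod (2 * n))) n
  have h0 := hν.2 0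
  rw [zero_add] at h0
  simp only [Nat.cast_add, Nat.cast_one, Nat.cast_zero, h0] at h
  have hmod := Finset.sum_int_mod (Finset.range n) 2
    (fun k : ℕ => ν ((k : ZMod (2 * n)) + 1) - ν k)
  rw [h] at hmod
  unfold par
  rw [Int.odd_iff, ← hmod]
  omega

/-- For a periodic binary string `μ` and an antiperiodic binary string `ν` on `ℤ/2n`:
flipping `μ` negates the phase `i^{T(μ,ν)}`, while flipping `ν` leaves the exponent
`T(μ,ν)` unchanged. This is the relation
`⟨ν ν̄|U₂₁|μ̄ μ̄⟩ = −⟨ν ν̄|U₂₁|μ μ⟩` together with `⟨ν̄ ν|U₂₁|μ μ⟩ = ⟨ν ν̄|U₂₁|μ μ⟩`. -/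
theorem Tmat_flip (n : ℕ) [NeZero n] (μ ν : ZMod (2 * n) → ℤ)
    (hμ : IsPeriodic n μ) (hν : IsAntiperiodic n ν) :
    Complex.I ^ Tmat (2 * n) (fun i => 1 - μ i) ν = -(Complex.I ^ Tmat (2 * n) μ ν) ∧
    Tmat (2 * n) μ (fun i => 1 - ν i) = Tmat (2 * n) μ ν := by
  refine ⟨?_, ?_⟩
  · have hS : Tmat (2 * n) (fun i => 1 - μ i) ν =
        (∑ i, par (ν (i + 1) - ν i)) - Tmat (2 * n) μ ν := by
      simp only [Tmat, sub_mul, one_mul, Finset.sum_sub_distrib]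
    have hT : Tmat (2 * n) μ ν =
        2 * ∑ k ∈ Finset.range n, μ k * par (ν ((k : ZMod (2 * n)) + 1) - ν k) :=
      ZMod.sum_eq_two_mul_sum_range n _ fun i => by rw [hμ.2, hν.par_add]
    rw [hS, hT, ZMod.sum_eq_two_mul_sum_range n _ hν.par_add, ← mul_sub, zpow_mul, zpow_mul]
    have hI : Complex.I ^ (2 : ℤ) = -1 := by
      rw [zpow_ofNat, Complex.I_sq]
    rw [hI, zpow_sub₀ (by norm_num), hν.odd_sum_par.neg_one_zpow, neg_div, one_div,
      ← inv_zpow, inv_neg_one]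
  · refine Finset.sum_congr rfl fun i _ => ?_
    rw [← par_neg (ν (i + 1) - ν i)]
    congr 2
    ring
end

section
/- For every n ≥ 1, an antiperiodic binary string ν : ℤ/2n → ℤ has domain-wall count congruent to 2 modulo 4: Σ_{i ∈ ℤ/2n} par(ν(i+1) − ν(i)) ≡ 2 (mod 4). -/
theorem ZMod.sum_univ_eq_sum_range {M : Type*} [AddCommMonoid M] (m : ℕ) [NeZero m]
    (f : ZMod m → M) : ∑ i : ZMod m, f i = ∑ k ∈ Finset.range m, f (k : ZMod m) := by
  refine Finset.sum_nbij' (fun i => i.val) (fun k => (k : ZMod m)) ?_ ?_ ?_ ?_ ?_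
  · exact fun i _ => Finset.mem_range.2 (ZMod.val_lt i)
  · simp
  · simp
  · exact fun k hk => ZMod.val_cast_of_lt (Finset.mem_range.1 hk)
  · simp

theorem sum_range_par_sub_modEq (u : ℕ → ℤ) (n : ℕ) :
    ∑ k ∈ Finset.range n, par (u (k + 1) - u k) ≡ u n - u 0 [ZMOD 2] := by
  rw [← Finset.sum_range_sub u n]
  exact Int.ModEq.sum fun k _ => Int.mod_modEq _ _

theorem IsAntiperiodic.par_sub_add {n : ℕ} {ν : ZMod (2 * n) → ℤ} (hν : IsAntiperiodic n ν)
    (i : ZMod (2 * n)) :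
    par (ν (i + n + 1) - ν (i + n)) = par (ν (i + 1) - ν i) := by
  rw [add_right_comm, hν.2, hν.2]
  unfold par
  omega

/-- An antiperiodic binary string on `ℤ/2n` has domain-wall count congruent to `2`
modulo `4`: `Σ_{i ∈ ℤ/2n} par(ν(i+1) − ν(i)) ≡ 2 (mod 4)`. -/
theorem antiperiodic_domain_wall_count (n : ℕ) [NeZero n] (ν : ZMod (2 * n) → ℤ)
    (hν : IsAntiperiodic n ν) :
    (∑ i : ZMod (2 * n), par (ν (i + 1) - ν i)) ≡ 2 [ZMOD 4] := by
  have hodd := sum_range_par_sub_modEq (fun k => ν (k : ZMod (2 * n))) n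
  have hn : ν (n : ZMod (2 * n)) = 1 - ν 0 := by simpa using hν.2 0
  have hsum : ∑ i : ZMod (2 * n), par (ν (i + 1) - ν i) =
      2 * ∑ k ∈ Finset.range n, par (ν ((k + 1 : ℕ) : ZMod (2 * n)) - ν (k : ZMod (2 * n))) := by
    rw [ZMod.sum_univ_eq_sum_range, congrArg Finset.range (two_mul n), Finset.sum_range_add,
      two_mul (Finset.sum _ _)]
    congr 1
    · simp
    · refine Finset.sum_congr rfl fun k _ => ?_
      rw [add_comm n k]
      push_cast
      exact hν.par_sub_add k
  rw [hsum]
  simp only [hn, Nat.cast_zero] at hodd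
  unfold Int.ModEq at *
  omega
end

section
/- For every n ≥ 1, the matrix M₁ of the duality symmetry U₁₁ satisfies M₁ᵀ · M₁ = (1/2)(I + F), where I is the identity matrix and F is the permutation matrix of the componentwise flip. (Hence √2·M₁ restricts to an orthogonal involution-candidate on the flip-symmetric subspace; this is the unitarity of U₁₁ on physical states.) -/
open Matrix

/-- `E_n(μ,ν) = Σ_{i ∈ ℤ/n} μ(i)·(ν(i+1) − ν(i))` for binary strings `μ, ν : ℤ/n → {0,1}`. -/
def Emat (n : ℕ) [NeZero n] (μ ν : ZMod n → Fin 2) : ℤ :=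
  ∑ i : ZMod n, ((μ i : ℕ) : ℤ) * (((ν (i + 1) : ℕ) : ℤ) - ((ν i : ℕ) : ℤ))

/-- The matrix `M₁` of the duality symmetry `U₁₁`, with entries
`M₁(ν,μ) = 2^{−(n+1)/2}·(−1)^{E_n(μ,ν)}`, indexed by binary strings on `ℤ/n`. -/
noncomputable def M1 (n : ℕ) [NeZero n] :
    Matrix (ZMod n → Fin 2) (ZMod n → Fin 2) ℝ :=
  fun ν μ => (2 : ℝ) ^ (-(((n : ℝ) + 1) / 2)) * (-1 : ℝ) ^ Emat n μ ν

/-- The permutation matrix `F` of the componentwise flip `μ ↦ 1−μ`. -/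
def flipMat (n : ℕ) [NeZero n] : Matrix (ZMod n → Fin 2) (ZMod n → Fin 2) ℝ :=
  fun ρ μ => if ρ = (fun i => 1 - μ i) then 1 else 0

/-- Summation by parts on the cycle: `E_n(μ,ν) = Σ_i ν(i)·(μ(i−1) − μ(i))`. -/
lemma Emat_eq_sum_mul_sub (n : ℕ) [NeZero n] (μ ν : ZMod n → Fin 2) :
    Emat n μ ν =
      ∑ i : ZMod n, ((ν i : ℕ) : ℤ) * (((μ (i - 1) : ℕ) : ℤ) - ((μ i : ℕ) : ℤ)) := by
  have h : ∑ i : ZMod n, ((μ i : ℕ) : ℤ) * ((ν (i + 1) : ℕ) : ℤ) =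
      ∑ i : ZMod n, ((μ (i - 1) : ℕ) : ℤ) * ((ν i : ℕ) : ℤ) :=
    Fintype.sum_equiv (Equiv.addRight (1 : ZMod n)) _ _ fun i => by simp
  simp only [Emat, mul_sub, Finset.sum_sub_distrib]
  rw [h]
  congr 1 <;> exact Finset.sum_congr rfl fun i _ => mul_comm _ _

lemma zpow_sum_eq_prod {ι : Type*} (s : Finset ι) {x : ℝ} (hx : x ≠ 0) (f : ι → ℤ) :
    x ^ (∑ i ∈ s, f i) = ∏ i ∈ s, x ^ f i := by
  classical
  induction s using Finset.induction_on with
  | empty => simp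
  | insert a s ha ih => rw [Finset.sum_insert ha, Finset.prod_insert ha, zpow_add₀ hx, ih]

/-- The character sum over all binary strings factors over the sites. -/
lemma sum_neg_one_zpow_eq_prod {ι : Type*} [Fintype ι] [DecidableEq ι] (d : ι → ℤ) :
    ∑ ν : ι → Fin 2, (-1 : ℝ) ^ (∑ i, ((ν i : ℕ) : ℤ) * d i) =
      ∏ i, (1 + (-1 : ℝ) ^ d i) := by
  have h : ∀ i, 1 + (-1 : ℝ) ^ d i = ∑ b : Fin 2, (-1 : ℝ) ^ (((b : ℕ) : ℤ) * d i) := by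
    intro i
    simp [Fin.sum_univ_two]
  simp_rw [h, zpow_sum_eq_prod _ (by norm_num : (-1 : ℝ) ≠ 0)]
  rw [Finset.prod_univ_sum, Fintype.piFinset_univ]

/-- A function on `ℤ/n` invariant under the shift by one is constant. -/
lemma ZMod.eq_apply_zero_of_apply_sub_one {α : Type*} {n : ℕ} [NeZero n] {f : ZMod n → α}
    (h : ∀ i, f (i - 1) = f i) (i : ZMod n) : f i = f 0 := by
  have key : ∀ k : ℕ, f (k : ZMod n) = f 0 := by
    intro k
    induction k with
    | zero => simp
    | succ k ih => rw [← h, Nat.cast_succ, add_sub_cancel_right, ih]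
  simpa using key i.val

/-- The parity condition at all sites says that the strings agree up to a global flip. -/
lemma forall_even_iff_eq_or_eq_flip (n : ℕ) [NeZero n] (μ ρ : ZMod n → Fin 2) :
    (∀ i, Even ((((μ (i - 1) : ℕ) : ℤ) - ((μ i : ℕ) : ℤ)) +
      (((ρ (i - 1) : ℕ) : ℤ) - ((ρ i : ℕ) : ℤ)))) ↔
      μ = ρ ∨ μ = fun i => 1 - ρ i := by
  have step : ∀ a b c d : Fin 2,
      Even ((((a : ℕ) : ℤ) - ((b : ℕ) : ℤ)) + (((c : ℕ) : ℤ) - ((d : ℕ) : ℤ))) ↔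
        a - c = b - d := by decide
  have flip : ∀ a b : Fin 2, a - b = 1 → a = 1 - b := by decide
  simp only [step]
  constructor
  · intro h
    have hc := ZMod.eq_apply_zero_of_apply_sub_one (f := fun i => μ i - ρ i) h
    have h01 : ∀ x : Fin 2, x = 0 ∨ x = 1 := by decide
    rcases h01 (μ 0 - ρ 0) with h0 | h0
    · exact Or.inl (funext fun i => sub_eq_zero.mp ((hc i).trans h0))
    · exact Or.inr (funext fun i => flip _ _ ((hc i).trans h0))
  · have self : ∀ a b : Fin 2, 1 - a - a = 1 - b - b := by decide
    rintro (rfl | rfl) i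
    · simp
    · exact self _ _

lemma prod_one_add_neg_one_zpow {ι : Type*} [Fintype ι] (d : ι → ℤ)
    [Decidable (∀ i, Even (d i))] :
    ∏ i, (1 + (-1 : ℝ) ^ d i) = if ∀ i, Even (d i) then 2 ^ Fintype.card ι else 0 := by
  split_ifs with h
  · simp only [(h _).neg_one_zpow]
    norm_num
  · push Not at h
    obtain ⟨i, hi⟩ := h
    exact Finset.prod_eq_zero (Finset.mem_univ i)
      (by simp [(Int.not_even_iff_odd.mp hi).neg_one_zpow])

lemma two_rpow_neg_half_mul_self (n : ℕ) :
    (2 : ℝ) ^ (-(((n : ℝ) + 1) / 2)) * (2 : ℝ) ^ (-(((n : ℝ) + 1) / 2)) * 2 ^ n = 1 / 2 := by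
  rw [← Real.rpow_natCast, ← Real.rpow_add two_pos, ← Real.rpow_add two_pos]
  ring_nf
  rw [Real.rpow_neg_one]
  norm_num

/-- Unitarity of `U₁₁` on physical states: `M₁ᵀ · M₁ = (1/2)(I + F)`. -/
theorem M1_transpose_mul_M1 (n : ℕ) [NeZero n] :
    (M1 n)ᵀ * M1 n = (1 / 2 : ℝ) • (1 + flipMat n) := by
  classical
  ext μ ρ
  have hsum : ∑ ν : ZMod n → Fin 2, (-1 : ℝ) ^ Emat n μ ν * (-1 : ℝ) ^ Emat n ρ ν =
      if μ = ρ ∨ μ = fun i => 1 - ρ i then 2 ^ n else 0 := by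
    simp_rw [← zpow_add₀ (by norm_num : (-1 : ℝ) ≠ 0), Emat_eq_sum_mul_sub,
      ← Finset.sum_add_distrib, ← mul_add]
    rw [sum_neg_one_zpow_eq_prod, prod_one_add_neg_one_zpow, ZMod.card]
    simp only [forall_even_iff_eq_or_eq_flip]
  have hne : ρ ≠ fun i => 1 - ρ i := fun h =>
    (by decide : ∀ a : Fin 2, a ≠ 1 - a) (ρ 0) (congrFun h 0)
  have hentry : ((M1 n)ᵀ * M1 n) μ ρ =
      (2 : ℝ) ^ (-(((n : ℝ) + 1) / 2)) * (2 : ℝ) ^ (-(((n : ℝ) + 1) / 2)) *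
        ∑ ν : ZMod n → Fin 2, (-1 : ℝ) ^ Emat n μ ν * (-1 : ℝ) ^ Emat n ρ ν := by
    simp only [Matrix.mul_apply, Matrix.transpose_apply, M1, Finset.mul_sum]
    exact Finset.sum_congr rfl fun ν _ => by ring
  rw [hentry, hsum, Matrix.smul_apply, Matrix.add_apply, Matrix.one_apply, flipMat, smul_eq_mul]
  by_cases h1 : μ = ρ
  · subst h1
    rw [if_pos (Or.inl rfl), if_pos rfl, if_neg hne, two_rpow_neg_half_mul_self]
    norm_num
  · by_cases h2 : μ = fun i => 1 - ρ i
    · rw [if_pos (Or.inr h2), if_neg h1, if_pos h2, two_rpow_neg_half_mul_self]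
      norm_num
    · simp [h1, h2]
end
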